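/- (Proposition 1, positive definiteness of the integral family.) Let D ≥ 1 with positive scale parameters θ_1,…,θ_D, let S ∈ (0,∞), let μ be a finite (nonnegative) measure on [0,S], let τ : [0,S] → [0,2] and ρ : [0,S] → ℕ be μ-measurable, and let α ≥ 0 and r ≥ 0 (playing the role of βλ with β, λ ≥ 0). Then the function (c,c') ↦ ∫_0^S (1 + r + α · (‖c − c'‖_θ)^{τ(s)})^{−ρ(s)} dμ(s) is a positive definite kernel on ℝ^D × ℝ^D, where ‖c − c'‖_θ² = Σ_{d=1}^{D} (c_d − c'_d)² / θ_d². -/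

import Mathlib

open scoped BigOperators

/-- A real-valued positive definite kernel on `X`. -/
def IsPDKernel {X : Type*} (k : X → X → ℝ) : Prop :=
  ∀ (m : ℕ) (x : Fin m → X) (a : Fin m → ℝ),
    0 ≤ ∑ i, ∑ j, a i * a j * k (x i) (x j)

/-- The weighted norm `‖c − c'‖_θ` with `‖c − c'‖_θ² = ∑ d, (c_d − c'_d)²/θ_d²`. -/
noncomputable def wnorm {D : ℕ} (θ : Fin D → ℝ) (c c' : Fin D → ℝ) : ℝ :=
  Real.sqrt (∑ d, (c d - c' d) ^ 2 / θ d ^ 2)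

/-- The quadratic form of a real matrix. -/
noncomputable def qform {m : ℕ} (A : Fin m → Fin m → ℝ) (a : Fin m → ℝ) : ℝ :=
  ∑ i, ∑ j, a i * a j * A i j

def PSDm {m : ℕ} (A : Fin m → Fin m → ℝ) : Prop :=
  (∀ i j, A i j = A j i) ∧ ∀ a, 0 ≤ qform A a

def CNDm {m : ℕ} (A : Fin m → Fin m → ℝ) : Prop :=
  (∀ i j, A i j = A j i) ∧ ∀ a : Fin m → ℝ, ∑ i, a i = 0 → qform A a ≤ 0

lemma psdm_iff {m : ℕ} (A : Fin m → Fin m → ℝ) :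
    PSDm A ↔ (Matrix.of A).PosSemidef := by
  rw [Matrix.posSemidef_iff_dotProduct_mulVec]
  unfold PSDm qform
  refine and_congr ?_ (forall_congr' fun a => ?_)
  · rw [Matrix.IsHermitian.ext_iff]
    simp only [Matrix.of_apply, star_trivial]
    exact ⟨fun h i j => h j i, fun h i j => h j i⟩
  · simp only [dotProduct, Matrix.mulVec, Matrix.of_apply, star_trivial, Finset.mul_sum]
    have : ∀ i j, a i * a j * A i j = a i * (A i j * a j) := fun i j => by ring
    simp only [this]

lemma PSDm.mul {m : ℕ} {A B : Fin m → Fin m → ℝ} (hA : PSDm A) (hB : PSDm B) :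
    PSDm (fun i j => A i j * B i j) := by
  rw [psdm_iff] at *
  exact hA.hadamard hB

lemma PSDm.rank1 {m : ℕ} (f : Fin m → ℝ) : PSDm (fun i j => f i * f j) := by
  refine ⟨fun i j => mul_comm _ _, fun a => ?_⟩
  have : qform (fun i j => f i * f j) a = (∑ i, a i * f i) ^ 2 := by
    unfold qform
    rw [sq, Finset.sum_mul_sum]
    exact Finset.sum_congr rfl fun i _ => Finset.sum_congr rfl fun j _ => by ring
  rw [this]; positivity

lemma PSDm.const {m : ℕ} {c : ℝ} (hc : 0 ≤ c) : PSDm (fun _ _ : Fin m => c) := by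
  have := PSDm.rank1 (fun _ : Fin m => Real.sqrt c)
  simpa only [Real.mul_self_sqrt hc] using this

lemma PSDm.pow {m : ℕ} {A : Fin m → Fin m → ℝ} (hA : PSDm A) (n : ℕ) :
    PSDm (fun i j => A i j ^ n) := by
  induction n with
  | zero => simpa using PSDm.const (m := m) zero_le_one
  | succ k ih => simpa only [pow_succ] using ih.mul hA

lemma PSDm.exp {m : ℕ} {A : Fin m → Fin m → ℝ} (hA : PSDm A) :
    PSDm (fun i j => Real.exp (A i j)) := by
  refine ⟨fun i j => by simp only [hA.1 i j], fun a => ?_⟩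
  have h : HasSum (fun n : ℕ => qform (fun i j => A i j ^ n / (n.factorial : ℝ)) a)
      (qform (fun i j => Real.exp (A i j)) a) := by
    unfold qform
    refine hasSum_sum fun i _ => hasSum_sum fun j _ => HasSum.mul_left _ ?_
    rw [Real.exp_eq_exp_ℝ]
    exact NormedSpace.expSeries_div_hasSum_exp (A i j)
  refine h.nonneg fun n => ?_
  have := ((hA.pow n).mul (PSDm.const (c := ((n.factorial : ℝ))⁻¹) (by positivity))).2 a
  simpa only [div_eq_mul_inv] using this

lemma qform_integral {m : ℕ} {Ω : Type*} [MeasurableSpace Ω] (ν : MeasureTheory.Measure Ω)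
    (F : Ω → Fin m → Fin m → ℝ)
    (hF : ∀ i j, MeasureTheory.Integrable (fun t => F t i j) ν) (a : Fin m → ℝ) :
    qform (fun i j => ∫ t, F t i j ∂ν) a = ∫ t, qform (F t) a ∂ν := by
  unfold qform
  rw [MeasureTheory.integral_finsetSum _ fun i _ => MeasureTheory.integrable_finsetSum _
    fun j _ => (hF i j).const_mul _]
  refine Finset.sum_congr rfl fun i _ => ?_
  rw [MeasureTheory.integral_finsetSum _ fun j _ => (hF i j).const_mul _]
  exact Finset.sum_congr rfl fun j _ => (MeasureTheory.integral_const_mul _ _).symm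

/-- Schoenberg. -/
lemma CNDm.exp_neg {m : ℕ} {N : Fin m → Fin m → ℝ} (hN : CNDm N) {u : ℝ} (hu : 0 ≤ u) :
    PSDm (fun i j => Real.exp (-(u * N i j))) := by
  rcases m with _ | m
  · exact ⟨fun i => i.elim0, fun a => by simp [qform]⟩
  have hK : PSDm (fun i j => N i 0 + N j 0 - N i j - N 0 0) := by
    refine ⟨fun i j => by simp only [hN.1 i j]; ring, fun a => ?_⟩
    set s := ∑ i, a i with hs
    have h := hN.2 (fun i => a i - if i = 0 then s else 0) (by simp [hs])
    have e1 : qform N (fun i => a i - if i = 0 then s else 0)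
        = qform N a - 2 * s * (∑ i, a i * N i 0) + s ^ 2 * N 0 0 := by
      unfold qform
      have : ∀ i j, (a i - if i = 0 then s else 0) * (a j - if j = 0 then s else 0) * N i j
        = a i * a j * N i j - (if j = 0 then s * a i * N i j else 0)
          - (if i = 0 then s * a j * N i j else 0)
          + (if i = 0 then (if j = 0 then s ^ 2 * N i j else 0) else 0) := by
        intro i j; split_ifs <;> ring
      simp only [this, Finset.sum_add_distrib, Finset.sum_sub_distrib]
      have h3 : ∑ i, ∑ j, (if i = 0 then s * a j * N i j else 0) = s * ∑ i, a i * N i 0 := by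
        rw [Finset.sum_comm, Finset.mul_sum]
        refine Finset.sum_congr rfl fun j _ => ?_
        simp [hN.1 0 j]; ring
      have h2 : ∑ i, ∑ j, (if j = 0 then s * a i * N i j else 0) = s * ∑ i, a i * N i 0 := by
        rw [Finset.mul_sum]
        refine Finset.sum_congr rfl fun j _ => ?_
        simp; ring
      have h4 : ∑ i, ∑ j, (if i = 0 then (if j = 0 then s ^ 2 * N i j else 0) else 0)
          = s ^ 2 * N 0 0 := by
        rw [Finset.sum_eq_single 0] <;> simp +contextual
      rw [h3, h2, h4]; ring
    have e2 : qform (fun i j => N i 0 + N j 0 - N i j - N 0 0) a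
        = -(qform N a - 2 * s * (∑ i, a i * N i 0) + s ^ 2 * N 0 0) := by
      unfold qform
      have : ∀ i j, a i * a j * (N i 0 + N j 0 - N i j - N 0 0)
        = (a i * N i 0) * a j + a i * (a j * N j 0) - a i * a j * N i j - a i * a j * N 0 0 := by
        intro i j; ring
      simp only [this, Finset.sum_add_distrib, Finset.sum_sub_distrib, ← Finset.sum_mul,
        ← Finset.mul_sum]
      simp only [← hs]; ring
    rw [e2, ← e1]; linarith
  have h1 := ((hK.mul (PSDm.const hu)).exp.mul
    (PSDm.rank1 (fun i => Real.exp (-(u * N i 0))))).mul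
      (PSDm.const (Real.exp_pos (u * N 0 0)).le)
  convert h1 using 3
  rw [← Real.exp_add, ← Real.exp_add, ← Real.exp_add]
  congr 1; ring

lemma CNDm.inv {m : ℕ} {N : Fin m → Fin m → ℝ} (hN : CNDm N) (h0 : ∀ i j, 0 ≤ N i j)
    {b α : ℝ} (hb : 0 < b) (hα : 0 ≤ α) :
    PSDm (fun i j => (b + α * N i j)⁻¹) := by
  refine ⟨fun i j => by simp only [hN.1 i j], fun a => ?_⟩
  have hp : ∀ i j, -(b + α * N i j) < 0 := fun i j => by
    have := mul_nonneg hα (h0 i j); linarith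
  have e : (fun i j => (b + α * N i j)⁻¹)
      = fun i j => ∫ u in Set.Ioi (0 : ℝ), Real.exp (-(b + α * N i j) * u) := by
    funext i j
    rw [integral_exp_mul_Ioi (hp i j)]
    rw [mul_zero, Real.exp_zero, neg_div_neg_eq, one_div]
  rw [e, qform_integral (F := fun u i j => Real.exp (-(b + α * N i j) * u)) _
    (fun i j => integrableOn_exp_mul_Ioi (hp i j) 0)]
  refine MeasureTheory.setIntegral_nonneg measurableSet_Ioi fun u hu => ?_
  have hu : 0 < u := hu
  have := ((hN.exp_neg (mul_nonneg hu.le hα)).mul (PSDm.const (Real.exp_pos (-(b * u))).le)).2 a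
  convert this using 4
  rw [← Real.exp_add]; congr 1; ring

lemma CNDm.rpow {m : ℕ} {N : Fin m → Fin m → ℝ} (hN : CNDm N) (h0 : ∀ i j, 0 ≤ N i j)
    {p : ℝ} (hp : p ∈ Set.Ioo (0 : ℝ) 1) : CNDm (fun i j => N i j ^ p) := by
  refine ⟨fun i j => by simp only [hN.1 i j], fun a ha => ?_⟩
  have hC := Real.integral_rpowIntegrand₀₁_one_pos hp
  set C := ∫ t in Set.Ioi (0 : ℝ), Real.rpowIntegrand₀₁ p t 1
  have e : (fun i j => N i j ^ p)
      = fun i j => C⁻¹ * ∫ t in Set.Ioi (0 : ℝ), Real.rpowIntegrand₀₁ p t (N i j) := by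
    funext i j
    exact Real.rpow_eq_const_mul_integral hp (h0 i j)
  have e2 : ∀ A : Fin m → Fin m → ℝ, ∀ c : ℝ,
      qform (fun i j => c * A i j) a = c * qform A a := fun A c => by
    simp only [qform, Finset.mul_sum]
    exact Finset.sum_congr rfl fun i _ => Finset.sum_congr rfl fun j _ => by ring
  rw [e, e2, qform_integral (F := fun t i j => Real.rpowIntegrand₀₁ p t (N i j)) _
    (fun i j => Real.integrableOn_rpowIntegrand₀₁_Ioi hp (h0 i j))]
  refine mul_nonpos_of_nonneg_of_nonpos (inv_nonneg.2 hC.le) ?_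
  refine MeasureTheory.setIntegral_nonpos measurableSet_Ioi fun t ht => ?_
  have ht : 0 < t := ht
  have h1 := (hN.inv h0 ht zero_le_one).2 a
  have h2 : qform (fun i j => Real.rpowIntegrand₀₁ p t (N i j)) a
      = t ^ p * (t⁻¹ * ((∑ i, a i) * (∑ j, a j)) - qform (fun i j => (t + 1 * N i j)⁻¹) a) := by
    rw [Finset.sum_mul_sum]
    simp only [qform, Real.rpowIntegrand₀₁, Finset.mul_sum,
      ← Finset.sum_sub_distrib]
    exact Finset.sum_congr rfl fun i _ => Finset.sum_congr rfl fun j _ => by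
      rw [one_mul]; ring
  rw [h2, ha]
  have := Real.rpow_nonneg ht.le p
  nlinarith [mul_nonneg this h1]

lemma cnd_wsq {D m : ℕ} (θ : Fin D → ℝ) (x : Fin m → Fin D → ℝ) :
    CNDm (fun i j => ∑ d, (x i d - x j d) ^ 2 / θ d ^ 2) := by
  refine ⟨fun i j => Finset.sum_congr rfl fun d _ => by ring, fun a ha => ?_⟩
  have : qform (fun i j => ∑ d, (x i d - x j d) ^ 2 / θ d ^ 2) a
      = ∑ d, (-2 * (∑ i, a i * x i d) ^ 2) / θ d ^ 2 := by
    unfold qform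
    simp only [Finset.mul_sum]
    have h1 : ∀ i, ∑ j, ∑ d, a i * a j * ((x i d - x j d) ^ 2 / θ d ^ 2)
      = ∑ d, ∑ j, a i * a j * ((x i d - x j d) ^ 2 / θ d ^ 2) := fun i => Finset.sum_comm
    simp only [h1]
    rw [Finset.sum_comm]
    refine Finset.sum_congr rfl fun d _ => ?_
    have h2 : ∀ i j, a i * a j * ((x i d - x j d) ^ 2 / θ d ^ 2)
      = ((a i * x i d ^ 2) * a j + a i * (a j * x j d ^ 2)
        - 2 * ((a i * x i d) * (a j * x j d))) / θ d ^ 2 := fun i j => by ring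
    simp only [h2, ← Finset.sum_div, Finset.sum_add_distrib, Finset.sum_sub_distrib,
      ← Finset.sum_mul, ← Finset.mul_sum, ha]
    congr 1; ring
  rw [this]
  refine Finset.sum_nonpos fun d _ => ?_
  refine div_nonpos_of_nonpos_of_nonneg ?_ (sq_nonneg _)
  nlinarith [sq_nonneg (∑ i, a i * x i d)]

lemma psd_point {D m : ℕ} (θ : Fin D → ℝ) (x : Fin m → Fin D → ℝ) {τ : ℝ}
    (hτ : τ ∈ Set.Icc (0 : ℝ) 2) {α r : ℝ} (hα : 0 ≤ α) (hr : 0 ≤ r) (n : ℕ) :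
    PSDm (fun i j => ((1 + r + α * wnorm θ (x i) (x j) ^ τ) ^ n)⁻¹) := by
  simp only [← inv_pow]
  refine PSDm.pow ?_ n
  have hb : 0 < 1 + r := by linarith
  have hq : ∀ i j, 0 ≤ ∑ d, (x i d - x j d) ^ 2 / θ d ^ 2 := fun i j =>
    Finset.sum_nonneg fun d _ => by positivity
  have hw : ∀ i j, wnorm θ (x i) (x j) ^ τ
      = (∑ d, (x i d - x j d) ^ 2 / θ d ^ 2) ^ (τ / 2) := fun i j => by
    rw [wnorm, Real.sqrt_eq_rpow, ← Real.rpow_mul (hq i j)]; congr 1; ring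
  simp only [hw]
  rcases hτ.1.eq_or_lt with h0 | h0
  · subst h0
    simpa using PSDm.const (m := m) (c := (1 + r + α)⁻¹) (by positivity)
  rcases hτ.2.eq_or_lt with h2 | h2
  · subst h2
    simpa using (cnd_wsq θ x).inv hq hb hα
  · exact ((cnd_wsq θ x).rpow hq ⟨by linarith, by linarith⟩).inv
      (fun i j => Real.rpow_nonneg (hq i j) _) hb hα

/-- Proposition 1 (positive definiteness of the integral family): for a finite measure `μ`
on `[0,S]`, measurable `τ : [0,S] → [0,2]` and `ρ : [0,S] → ℕ`, and `α, r ≥ 0`, the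
function `(c,c') ↦ ∫_0^S (1 + r + α‖c−c'‖_θ^{τ(s)})^{−ρ(s)} dμ(s)` is a positive
definite kernel on `ℝ^D × ℝ^D`. -/
theorem integral_fm_family_pd {D : ℕ} (hD : 1 ≤ D)
    (θ : Fin D → ℝ) (hθ : ∀ d, 0 < θ d)
    (S : ℝ) (hS : 0 < S)
    (μ : MeasureTheory.Measure ℝ) [MeasureTheory.IsFiniteMeasure μ]
    (hμ : μ (Set.Icc 0 S)ᶜ = 0)
    (τ : ℝ → ℝ) (hτmeas : Measurable τ) (hτ : ∀ s ∈ Set.Icc (0 : ℝ) S, τ s ∈ Set.Icc (0 : ℝ) 2)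
    (ρ : ℝ → ℕ) (hρmeas : Measurable ρ)
    (α r : ℝ) (hα : 0 ≤ α) (hr : 0 ≤ r) :
    IsPDKernel (fun c c' : Fin D → ℝ =>
      ∫ s in Set.Icc (0 : ℝ) S, ((1 + r + α * wnorm θ c c' ^ τ s) ^ ρ s)⁻¹ ∂μ) := by
  intro m x a
  have hint : ∀ i j, MeasureTheory.Integrable
      (fun s => ((1 + r + α * wnorm θ (x i) (x j) ^ τ s) ^ ρ s)⁻¹)
      (μ.restrict (Set.Icc (0 : ℝ) S)) := by
    intro i j
    have hw : 0 ≤ wnorm θ (x i) (x j) := Real.sqrt_nonneg _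
    refine MeasureTheory.Integrable.of_bound (C := 1) ?_ (Filter.Eventually.of_forall fun s => ?_)
    · have hm : Measurable (fun s => ((1 + r + α * wnorm θ (x i) (x j) ^ τ s) ^ ρ s)⁻¹) :=
        (((hτmeas.const_pow _).const_mul α |>.const_add (1 + r)).pow hρmeas).inv
      exact hm.aestronglyMeasurable
    · have h1 : 1 ≤ 1 + r + α * wnorm θ (x i) (x j) ^ τ s := by
        have := mul_nonneg hα (Real.rpow_nonneg hw (τ s)); linarith
      have h2 := one_le_pow₀ h1 (n := ρ s)
      rw [Real.norm_of_nonneg (by positivity)]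
      exact inv_le_one_of_one_le₀ h2
  have h := qform_integral (μ.restrict (Set.Icc (0 : ℝ) S))
    (fun s i j => ((1 + r + α * wnorm θ (x i) (x j) ^ τ s) ^ ρ s)⁻¹) hint a
  have h2 : 0 ≤ ∫ s in Set.Icc (0 : ℝ) S,
      qform (fun i j => ((1 + r + α * wnorm θ (x i) (x j) ^ τ s) ^ ρ s)⁻¹) a ∂μ :=
    MeasureTheory.setIntegral_nonneg measurableSet_Icc fun s hs =>
      (psd_point θ x (hτ s hs) hα hr (ρ s)).2 a
  rw [← h] at h2
  exact h2
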